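/- Let 1 < p < ∞, let w ∈ A_p be a weight on ℝⁿ, and let b satisfy ‖b‖_{BMO_{1,w}} := sup_Q (1/w(Q)) ∫_Q |b − b_Q| dx < ∞. Then for every cube Q, ( (1/w(Q)) ∫_Q |(b(x) − b_Q)/w(x)|^{p'} w(x) dx )^{1/p'} ≤ c_n · p' · ‖b‖_{BMO_{1,w}} · [w]_{A_p}^{1/p} · [w]_{A∞}^{1/p'}, where c_n is a dimensional constant and 1/p + 1/p' = 1. -/

import Mathlib

open MeasureTheory ENNReal Set

noncomputable section

/-- The axis-parallel cube in `ℝⁿ` with lower corner `a` and side length `h`. -/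
def Cube {n : ℕ} (a : Fin n → ℝ) (h : ℝ) : Set (Fin n → ℝ) :=
  Set.univ.pi fun i => Set.Icc (a i) (a i + h)

/-- The concentric double `2Q` of the cube with lower corner `a` and side length `h`. -/
def Cube2 {n : ℕ} (a : Fin n → ℝ) (h : ℝ) : Set (Fin n → ℝ) :=
  Cube (fun i => a i - h / 2) (2 * h)

/-- The average `f_Q` of `f` over the cube with lower corner `a` and side length `h`. -/
def cubeAvg {n : ℕ} (a : Fin n → ℝ) (h : ℝ) (f : (Fin n → ℝ) → ℝ) : ℝ :=
  ⨍ x in Cube a h, f x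

/-- The (uncentered) Hardy–Littlewood maximal function over axis-parallel cubes. -/
def maxFn {n : ℕ} (f : (Fin n → ℝ) → ℝ) (x : Fin n → ℝ) : ℝ≥0∞ :=
  ⨆ (a : Fin n → ℝ) (h : ℝ) (_ : 0 < h) (_ : x ∈ Cube a h),
    (∫⁻ y in Cube a h, ENNReal.ofReal |f y|) / volume (Cube a h)

/-- The BMO seminorm `sup_Q (1/|Q|) ∫_Q |f - f_Q|`, valued in `ℝ≥0∞`. -/
def bmoNorm {n : ℕ} (f : (Fin n → ℝ) → ℝ) : ℝ≥0∞ :=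
  ⨆ (a : Fin n → ℝ) (h : ℝ) (_ : 0 < h),
    (∫⁻ x in Cube a h, ENNReal.ofReal |f x - cubeAvg a h f|) / volume (Cube a h)

/-- The generalized weighted BMO norm `‖f‖_{BMO_{v,Y}} = sup_Q (1/Y(Q)) ∫_Q |f - f_Q| v`. -/
def bmoVY {n : ℕ} (v : (Fin n → ℝ) → ℝ) (Y : (Fin n → ℝ) → ℝ → ℝ≥0∞)
    (f : (Fin n → ℝ) → ℝ) : ℝ≥0∞ :=
  ⨆ (a : Fin n → ℝ) (h : ℝ) (_ : 0 < h),
    (∫⁻ x in Cube a h, ENNReal.ofReal (|f x - cubeAvg a h f| * v x)) / Y a h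

/-- `w(Q) = ∫_Q w` for a cube `Q`. -/
def wInt {n : ℕ} (w : (Fin n → ℝ) → ℝ) (a : Fin n → ℝ) (h : ℝ) : ℝ≥0∞ :=
  ∫⁻ x in Cube a h, ENNReal.ofReal (w x)

/-- `w(2Q) = ∫_{2Q} w` for a cube `Q`. -/
def wInt2 {n : ℕ} (w : (Fin n → ℝ) → ℝ) (a : Fin n → ℝ) (h : ℝ) : ℝ≥0∞ :=
  ∫⁻ x in Cube2 a h, ENNReal.ofReal (w x)

/-- The generalized Fujii–Wilson constant `[v]_{A_{∞,Y}} = sup_Q (1/Y(Q)) ∫_Q M(v χ_Q)`. -/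
def fwY {n : ℕ} (v : (Fin n → ℝ) → ℝ) (Y : (Fin n → ℝ) → ℝ → ℝ≥0∞) : ℝ≥0∞ :=
  ⨆ (a : Fin n → ℝ) (h : ℝ) (_ : 0 < h),
    (∫⁻ x in Cube a h, maxFn ((Cube a h).indicator v) x) / Y a h

/-- The Fujii–Wilson `A∞` constant `[w]_{A∞} = sup_Q (1/w(Q)) ∫_Q M(w χ_Q)`. -/
def fwConst {n : ℕ} (w : (Fin n → ℝ) → ℝ) : ℝ≥0∞ :=
  ⨆ (a : Fin n → ℝ) (h : ℝ) (_ : 0 < h),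
    (∫⁻ x in Cube a h, maxFn ((Cube a h).indicator w) x) / wInt w a h

/-- The weak Fujii–Wilson constant `[w]^{weak}_{A∞} = sup_Q (1/w(2Q)) ∫_Q M(w χ_Q)`. -/
def fwWeak {n : ℕ} (w : (Fin n → ℝ) → ℝ) : ℝ≥0∞ :=
  ⨆ (a : Fin n → ℝ) (h : ℝ) (_ : 0 < h),
    (∫⁻ x in Cube a h, maxFn ((Cube a h).indicator w) x) / wInt2 w a h

/-- The `C_p` normalizing functional `Y(Q) = ∫_{ℝⁿ} M(χ_Q)^p w`. -/
def cpY {n : ℕ} (p : ℝ) (w : (Fin n → ℝ) → ℝ) (a : Fin n → ℝ) (h : ℝ) : ℝ≥0∞ :=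
  ∫⁻ x, (maxFn ((Cube a h).indicator fun _ => (1 : ℝ)) x) ^ p * ENNReal.ofReal (w x)

/-- The `C_p` Fujii–Wilson-type constant `[w]_{C_p}`. -/
def cpConst {n : ℕ} (p : ℝ) (w : (Fin n → ℝ) → ℝ) : ℝ≥0∞ :=
  ⨆ (a : Fin n → ℝ) (h : ℝ) (_ : 0 < h),
    (∫⁻ x in Cube a h, maxFn ((Cube a h).indicator w) x) / cpY p w a h

/-- The `A_p` constant `[w]_{A_p}` for `1 < p < ∞`. -/
def apConst {n : ℕ} (p : ℝ) (w : (Fin n → ℝ) → ℝ) : ℝ≥0∞ :=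
  ⨆ (a : Fin n → ℝ) (h : ℝ) (_ : 0 < h),
    (wInt w a h / volume (Cube a h)) *
      ((∫⁻ x in Cube a h, ENNReal.ofReal (w x) ^ (1 - p / (p - 1))) / volume (Cube a h)) ^ (p - 1)

/-- A weight: a nonnegative locally integrable function on `ℝⁿ`. -/
def IsWeight {n : ℕ} (v : (Fin n → ℝ) → ℝ) : Prop :=
  (∀ x, 0 ≤ v x) ∧ LocallyIntegrable v volume

/-- A cube functional `Y : 𝒬 → (0,∞)`: positive finite values on cubes. -/
def IsCubeFunctional {n : ℕ} (Y : (Fin n → ℝ) → ℝ → ℝ≥0∞) : Prop :=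
  ∀ (a : Fin n → ℝ) (h : ℝ), 0 < h → 0 < Y a h ∧ Y a h < ⊤

/-- Membership in the class `𝒴_q` with constant `β`: for every cube `Q`, every `L ≥ 1`
and every `L`-small family of pairwise non-overlapping subcubes of `Q`,
`∑_{P ∈ Λ} Y(P) ≤ β Y(Q) L^{-1/q}`. -/
def MemY {n : ℕ} (q β : ℝ) (Y : (Fin n → ℝ) → ℝ → ℝ≥0∞) : Prop :=
  ∀ (a : Fin n → ℝ) (h : ℝ), 0 < h → ∀ L : ℝ, 1 ≤ L →
    ∀ Λ : Set ((Fin n → ℝ) × ℝ),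
      (∀ p ∈ Λ, 0 < p.2 ∧ Cube p.1 p.2 ⊆ Cube a h) →
      (Λ.Pairwise fun p r => Disjoint (interior (Cube p.1 p.2)) (interior (Cube r.1 r.2))) →
      (∑' p : Λ, volume (Cube p.1.1 p.1.2)) ≤ volume (Cube a h) / ENNReal.ofReal L →
      (∑' p : Λ, Y p.1.1 p.1.2) ≤ ENNReal.ofReal β * Y a h * ENNReal.ofReal (L ^ (-1 / q))

/-- The Luxemburg norm in the Orlicz space `exp L^β` with respect to the measure `μ`. -/
def expLuxNorm {X : Type*} [MeasurableSpace X] (μ : Measure X) (β : ℝ) (g : X → ℝ) : ℝ≥0∞ :=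
  ⨅ (lam : ℝ) (_ : 0 < lam)
    (_ : ∫⁻ x, ENNReal.ofReal (Real.exp ((|g x| / lam) ^ β) - 1) ∂μ ≤ 1), ENNReal.ofReal lam

/-- The weighted measure `w dx` restricted to a set `Q`. -/
def wMeasureOn {n : ℕ} (w : (Fin n → ℝ) → ℝ) (Q : Set (Fin n → ℝ)) : Measure (Fin n → ℝ) :=
  (volume.restrict Q).withDensity fun x => ENNReal.ofReal (w x)

/-- The dyadic grid `𝒟(Q)` relative to the cube with lower corner `a₀` and side `h₀`:
parameters of all dyadic subcubes of `Q`. -/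
def dyadicOf {n : ℕ} (a₀ : Fin n → ℝ) (h₀ : ℝ) : Set ((Fin n → ℝ) × ℝ) :=
  {p | ∃ (k : ℕ) (m : Fin n → ℕ), (∀ i, m i < 2 ^ k) ∧
    p.2 = h₀ / 2 ^ k ∧ p.1 = fun i => a₀ i + (m i : ℝ) * (h₀ / 2 ^ k)}

/-- The functional `w_r(Q) = |Q| ((1/|Q|) ∫_Q w^r)^{1/r}`. -/
def wrY {n : ℕ} (w : (Fin n → ℝ) → ℝ) (r : ℝ) (a : Fin n → ℝ) (h : ℝ) : ℝ≥0∞ :=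
  volume (Cube a h) *
    ((∫⁻ x in Cube a h, ENNReal.ofReal (w x) ^ r) / volume (Cube a h)) ^ (1 / r)

section SparseTree

variable {X ι : Type*}

/-- The sum of `l` over the first `N` generations of descendants of `i`, as a function on `X`. -/
def sparseSum (D : ι → Set X) (ch : ι → Set ι) (l : ι → ℝ≥0∞) : ℕ → ι → X → ℝ≥0∞
  | 0, _, _ => 0
  | N + 1, i, x => (D i).indicator (fun _ => l i) x + ∑' j : ch i, sparseSum D ch l N j x

/-- The union of the descendants of `i` of generation `N`. -/
def generation (D : ι → Set X) (ch : ι → Set ι) : ℕ → ι → Set X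
  | 0, i => D i
  | N + 1, i => ⋃ j : ch i, generation D ch N j

/-- A tree of sets in which the children of a set are disjoint and fill at most half of it. -/
structure IsSparseTree [MeasurableSpace X] (μ : Measure X) (D : ι → Set X) (ch : ι → Set ι) :
    Prop where
  measurableSet : ∀ i, MeasurableSet (D i)
  measure_ne_top : ∀ i, μ (D i) ≠ ∞
  disjoint : ∀ i, (ch i).PairwiseDisjoint D
  subset : ∀ i, ∀ j ∈ ch i, D j ⊆ D i
  half : ∀ i, 2 * ∑' j : ch i, μ (D j) ≤ μ (D i)

theorem ENNReal.add_rpow_le_add_mul (x y : ℝ≥0∞) {t : ℝ} (ht : 1 ≤ t) :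
    (x + y) ^ t ≤ x ^ t + ENNReal.ofReal t * y * (x + y) ^ (t - 1) := by
  have ht0 : 0 < t := by linarith
  have hot : ENNReal.ofReal t ≠ 0 := by simpa using ht0
  by_cases hx : x = ∞
  · simp [hx, ht0]
  by_cases hy : y = ∞
  · rcases ht.eq_or_lt with rfl | h1
    · simp [hy]
    · have : (∞ : ℝ≥0∞) ^ (t - 1) = ∞ := by simp [h1]
      simp [hy, this, ht0, ENNReal.mul_top hot]
  lift x to NNReal using hx
  lift y to NNReal using hy
  rw [← ENNReal.coe_add, ← ENNReal.coe_rpow_of_nonneg _ ht0.le,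
    ← ENNReal.coe_rpow_of_nonneg _ ht0.le,
    ← ENNReal.coe_rpow_of_nonneg _ (by linarith : 0 ≤ t - 1), ENNReal.ofReal,
    ← ENNReal.coe_mul, ← ENNReal.coe_mul, ← ENNReal.coe_add, ENNReal.coe_le_coe,
    ← NNReal.coe_le_coe]
  push_cast
  rw [Real.coe_toNNReal _ ht0.le]
  have hx := x.2
  have hy := y.2
  change (0 : ℝ) ≤ (x : ℝ) at hx
  change (0 : ℝ) ≤ (y : ℝ) at hy
  generalize (x : ℝ) = a at hx ⊢
  generalize (y : ℝ) = b at hy ⊢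
  rcases (add_nonneg hx hy).eq_or_lt with h0 | h0
  · rw [← h0, Real.zero_rpow ht0.ne']
    positivity
  · have hb := one_add_mul_self_le_rpow_one_add (s := -(b / (a + b))) (by
      rw [neg_le_neg_iff, div_le_one h0]; linarith) ht
    have e : 1 + -(b / (a + b)) = a / (a + b) := by field_simp; ring
    rw [e, Real.div_rpow hx h0.le, le_div_iff₀ (by positivity)] at hb
    have e2 : (a + b) ^ t = (a + b) ^ (t - 1) * (a + b) := by
      rw [← Real.rpow_add_one h0.ne']; ring_nf
    have e3 : (1 + t * -(b / (a + b))) * (a + b) ^ t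
        = (a + b) ^ t - t * b * (a + b) ^ (t - 1) := by
      rw [e2]; field_simp; ring
    rw [e3] at hb
    linarith

theorem ENNReal.tsum_mul_rpow_le {κ : Type*} [Countable κ] (f g : κ → ℝ≥0∞) {p q : ℝ}
    (hp : 0 ≤ p) (hq : 0 ≤ q) (hpq : p + q = 1) :
    ∑' k, f k ^ p * g k ^ q ≤ (∑' k, f k) ^ p * (∑' k, g k) ^ q := by
  let _ : MeasurableSpace κ := ⊤
  have := ENNReal.lintegral_mul_norm_pow_le (μ := Measure.count) (f := f) (g := g)
    (Measurable.of_discrete.aemeasurable) (Measurable.of_discrete.aemeasurable) hp hq hpq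
  simpa only [lintegral_count] using this

theorem ENNReal.tsum_rpow_of_subsingleton {κ : Type*} (f : κ → ℝ≥0∞) {t : ℝ} (ht : 0 < t)
    (h : ∀ j k, f j ≠ 0 → f k ≠ 0 → j = k) : (∑' k, f k) ^ t = ∑' k, f k ^ t := by
  by_cases h0 : ∃ j, f j ≠ 0
  · obtain ⟨j, hj⟩ := h0
    have hz : ∀ k, k ≠ j → f k = 0 := fun k hk => by
      by_contra hne
      exact hk (h k j hne hj)
    rw [tsum_eq_single j hz, tsum_eq_single j fun k hk => by simp [hz k hk, ht]]
  · push Not at h0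
    simp [h0, ht]

theorem two_rpow_neg_add_half_le {y : ℝ} (h0 : 0 ≤ y) (h1 : y ≤ 1) :
    (1 / 2 : ℝ) ^ y + y / 2 ≤ 1 := by
  have h := rpow_one_add_le_one_add_mul_self (s := -(1 / 2)) (by norm_num) h0 h1
  norm_num at h ⊢
  linarith

variable {D : ι → Set X} {ch : ι → Set ι} {l : ι → ℝ≥0∞}

theorem sparseSum_eq_zero_of_notMem (hsub : ∀ i, ∀ j ∈ ch i, D j ⊆ D i) :
    ∀ (N : ℕ) (i : ι) {x : X}, x ∉ D i → sparseSum D ch l N i x = 0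
  | 0, _, _, _ => rfl
  | N + 1, i, x, hx => by
    simp only [sparseSum, indicator_of_notMem hx, zero_add, ENNReal.tsum_eq_zero]
    exact fun j => sparseSum_eq_zero_of_notMem hsub N j fun h => hx (hsub i j j.2 h)

theorem sparseSum_le_succ : ∀ (N : ℕ) (i : ι) (x : X),
    sparseSum D ch l N i x ≤ sparseSum D ch l (N + 1) i x
  | 0, _, _ => zero_le
  | N + 1, i, x => by
    rw [sparseSum, sparseSum]
    gcongr
    exact sparseSum_le_succ N _ x

variable [MeasurableSpace X] {μ ν : Measure X}

theorem measurable_sparseSum [Countable ι] (hD : ∀ i, MeasurableSet (D i)) :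
    ∀ (N : ℕ) (i : ι), Measurable (sparseSum D ch l N i)
  | 0, _ => measurable_const
  | N + 1, i => by
    refine (measurable_const.indicator (hD i)).add (Measurable.tsum fun j => ?_)
    exact measurable_sparseSum hD N j

namespace IsSparseTree

theorem measure_generation_le (T : IsSparseTree μ D ch) [Countable ι] :
    ∀ (N : ℕ) (i : ι), 2 ^ N * μ (generation D ch N i) ≤ μ (D i)
  | 0, i => by simp [generation]
  | N + 1, i => calc
      2 ^ (N + 1) * μ (generation D ch (N + 1) i)
        ≤ 2 * ∑' j : ch i, 2 ^ N * μ (generation D ch N j) := by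
          rw [ENNReal.tsum_mul_left, ← mul_assoc, pow_succ']
          gcongr
          exact measure_iUnion_le _
      _ ≤ 2 * ∑' j : ch i, μ (D j) := by
          gcongr
          exact measure_generation_le T N _
      _ ≤ μ (D i) := T.half i

theorem measure_iInter_generation (T : IsSparseTree μ D ch) [Countable ι] (i : ι) :
    μ (⋂ N, generation D ch N i) = 0 := by
  have h : ∀ N : ℕ, μ (⋂ N, generation D ch N i) ≤ μ (D i) * 2⁻¹ ^ N := fun N => by
    rw [← ENNReal.inv_pow, ← div_eq_mul_inv, ENNReal.le_div_iff_mul_le (by simp) (by simp),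
      mul_comm]
    refine le_trans ?_ (T.measure_generation_le N i)
    gcongr
    exact iInter_subset _ N
  have ht : Filter.Tendsto (fun N : ℕ => μ (D i) * 2⁻¹ ^ N) Filter.atTop (nhds (μ (D i) * 0)) :=
    ENNReal.Tendsto.const_mul (ENNReal.tendsto_pow_atTop_nhds_zero_of_lt_one (by simp))
      (Or.inr (T.measure_ne_top i))
  rw [mul_zero] at ht
  exact le_antisymm (ge_of_tendsto' ht h) zero_le

theorem tsum_measure_le (T : IsSparseTree μ D ch) [Countable ι] (ν : Measure X) (i : ι) :
    ∑' j : ch i, ν (D j) ≤ ν (D i) := by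
  have hd : Pairwise (Function.onFun Disjoint fun j : ch i => D j) :=
    fun j k hjk => T.disjoint i j.2 k.2 (Subtype.coe_ne_coe.2 hjk)
  rw [← measure_iUnion hd fun j => T.measurableSet j]
  exact measure_mono (iUnion_subset fun j => T.subset i j j.2)

theorem setLIntegral_tsum_rpow (T : IsSparseTree μ D ch) [Countable ι] (ν : Measure X)
    (N : ℕ) (i : ι) {t : ℝ} (ht : 0 < t) :
    ∫⁻ x in D i, (∑' j : ch i, sparseSum D ch l N j x) ^ t ∂ν
      = ∑' j : ch i, ∫⁻ x in D j, sparseSum D ch l N j x ^ t ∂ν := by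
  have h0 : ∀ j {x}, x ∉ D j → sparseSum D ch l N j x = 0 :=
    fun j _ => sparseSum_eq_zero_of_notMem T.subset N j
  have h : ∀ x, (∑' j : ch i, sparseSum D ch l N j x) ^ t
      = ∑' j : ch i, sparseSum D ch l N j x ^ t := fun x =>
    ENNReal.tsum_rpow_of_subsingleton _ ht fun j k hj hk => by
      by_contra hne
      exact disjoint_left.1 (T.disjoint i j.2 k.2 (Subtype.coe_ne_coe.2 hne))
        (not_imp_comm.1 (h0 j) hj) (not_imp_comm.1 (h0 k) hk)
  simp_rw [h]
  rw [lintegral_tsum fun j =>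
    ((measurable_sparseSum T.measurableSet N _).pow_const t).aemeasurable]
  refine tsum_congr fun j => ?_
  rw [← lintegral_indicator (T.measurableSet i), ← lintegral_indicator (T.measurableSet j)]
  refine lintegral_congr fun x => ?_
  by_cases hx : x ∈ D j
  · rw [indicator_of_mem hx, indicator_of_mem (T.subset i j j.2 hx)]
  · rw [indicator_of_notMem hx, indicator_apply_eq_zero]
    intro _
    rw [h0 j hx, ENNReal.zero_rpow_of_pos ht]

theorem lintegral_succ_le_of_one_le (T : IsSparseTree μ D ch) [Countable ι] (ν : Measure X)
    (N : ℕ) (i : ι) {t : ℝ} (ht : 1 ≤ t) :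
    ∫⁻ x in D i, sparseSum D ch l (N + 1) i x ^ t ∂ν
      ≤ (∑' j : ch i, ∫⁻ x in D j, sparseSum D ch l N j x ^ t ∂ν) +
        ENNReal.ofReal t * l i * ∫⁻ x in D i, sparseSum D ch l (N + 1) i x ^ (t - 1) ∂ν := by
  have hm := measurable_sparseSum (l := l) (ch := ch) T.measurableSet
  rw [← T.setLIntegral_tsum_rpow ν N i (by linarith : 0 < t),
    ← lintegral_const_mul _ ((hm _ i).pow_const _),
    ← lintegral_add_right _ (((hm _ i).pow_const _).const_mul _)]
  refine setLIntegral_mono' (T.measurableSet i) fun x hx => ?_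
  rw [sparseSum, indicator_of_mem hx, add_comm (l i)]
  exact ENNReal.add_rpow_le_add_mul _ _ ht

theorem lintegral_succ_le_of_le_one (T : IsSparseTree μ D ch) [Countable ι] (ν : Measure X)
    (N : ℕ) (i : ι) {t : ℝ} (ht0 : 0 < t) (ht : t ≤ 1) :
    ∫⁻ x in D i, sparseSum D ch l (N + 1) i x ^ t ∂ν
      ≤ (∑' j : ch i, ∫⁻ x in D j, sparseSum D ch l N j x ^ t ∂ν) + l i ^ t * ν (D i) := by
  rw [← T.setLIntegral_tsum_rpow ν N i ht0, ← setLIntegral_const,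
    ← lintegral_add_right _ measurable_const]
  refine setLIntegral_mono' (T.measurableSet i) fun x hx => ?_
  rw [sparseSum, indicator_of_mem hx, add_comm (l i)]
  exact ENNReal.rpow_add_le_add_rpow _ _ ht0.le ht

variable {s : ℝ} {A : ℝ≥0∞}

/-- The passage from the exponent `t - 1` to the exponent `t`. -/
theorem lintegral_rpow_step (T : IsSparseTree μ D ch) [Countable ι] (hs : 1 ≤ s)
    (hA : ∀ i, l i ^ s * ν (D i) ≤ A * μ (D i)) {t : ℝ} (ht : 1 ≤ t) (hts : t ≤ s)
    (ih : ∀ N i, ∫⁻ x in D i, sparseSum D ch l N i x ^ (t - 1) ∂ν ≤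
      ENNReal.ofReal ((2 * s) ^ (t - 1)) *
        (ν (D i) ^ (1 - (t - 1) / s) * (A * μ (D i)) ^ ((t - 1) / s))) :
    ∀ N i, ∫⁻ x in D i, sparseSum D ch l N i x ^ t ∂ν ≤
      ENNReal.ofReal ((2 * s) ^ t) * (ν (D i) ^ (1 - t / s) * (A * μ (D i)) ^ (t / s)) := by
  have hs0 : 0 < s := by linarith
  have ht0 : 0 < t := by linarith
  have hy0 : 0 ≤ t / s := by positivity
  have hy1 : t / s ≤ 1 := (div_le_one hs0).2 hts
  intro N
  induction N with
  | zero => intro i; simp [sparseSum, ht0]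
  | succ N ihN =>
    intro i
    refine (T.lintegral_succ_le_of_one_le ν N i ht).trans ?_
    have h1 : (∑' j : ch i, ∫⁻ x in D j, sparseSum D ch l N j x ^ t ∂ν) ≤
        ENNReal.ofReal ((2 * s) ^ t * (1 / 2) ^ (t / s)) *
          (ν (D i) ^ (1 - t / s) * (A * μ (D i)) ^ (t / s)) := calc
      _ ≤ ∑' j : ch i, ENNReal.ofReal ((2 * s) ^ t) *
          (ν (D j) ^ (1 - t / s) * (A * μ (D j)) ^ (t / s)) :=
        ENNReal.tsum_le_tsum fun j => ihN j
      _ ≤ ENNReal.ofReal ((2 * s) ^ t) * ((∑' j : ch i, ν (D j)) ^ (1 - t / s) *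
          (∑' j : ch i, A * μ (D j)) ^ (t / s)) := by
        rw [ENNReal.tsum_mul_left]
        gcongr
        exact ENNReal.tsum_mul_rpow_le _ _ (by linarith) hy0 (by ring)
      _ ≤ ENNReal.ofReal ((2 * s) ^ t) * (ν (D i) ^ (1 - t / s) *
          (ENNReal.ofReal (1 / 2) * (A * μ (D i))) ^ (t / s)) := by
        gcongr
        · exact T.tsum_measure_le ν i
        · rw [ENNReal.tsum_mul_left, mul_left_comm]
          gcongr
          have h2 : (ENNReal.ofReal (1 / 2)) = 2⁻¹ := by
            rw [one_div, ENNReal.ofReal_inv_of_pos (by norm_num), ENNReal.ofReal_ofNat]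
          rw [h2, mul_comm, ← div_eq_mul_inv,
            ENNReal.le_div_iff_mul_le (by simp) (by simp), mul_comm]
          exact T.half i
      _ = _ := by
        rw [ENNReal.mul_rpow_of_nonneg _ _ hy0, ENNReal.ofReal_rpow_of_nonneg (by norm_num) hy0,
          ENNReal.ofReal_mul (by positivity)]
        ring
    have h2 : ENNReal.ofReal t * l i * ∫⁻ x in D i, sparseSum D ch l (N + 1) i x ^ (t - 1) ∂ν ≤
        ENNReal.ofReal ((2 * s) ^ t * (t / s / 2)) *
          (ν (D i) ^ (1 - t / s) * (A * μ (D i)) ^ (t / s)) := by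
      have h3 : l i * ν (D i) ^ (1 / s) ≤ (A * μ (D i)) ^ (1 / s) := by
        have := ENNReal.rpow_le_rpow (hA i) (by positivity : 0 ≤ 1 / s)
        rwa [ENNReal.mul_rpow_of_nonneg _ _ (by positivity), ← ENNReal.rpow_mul,
          mul_one_div_cancel hs0.ne', ENNReal.rpow_one] at this
      have h4 : (2 * s) ^ t * (t / s / 2) = t * (2 * s) ^ (t - 1) := by
        rw [Real.rpow_sub_one (by positivity)]
        field_simp
      calc
        _ ≤ ENNReal.ofReal t * l i * (ENNReal.ofReal ((2 * s) ^ (t - 1)) *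
            (ν (D i) ^ (1 - (t - 1) / s) * (A * μ (D i)) ^ ((t - 1) / s))) := by
          gcongr
          exact ih _ _
        _ = ENNReal.ofReal (t * (2 * s) ^ (t - 1)) * (ν (D i) ^ (1 - t / s) *
            ((l i * ν (D i) ^ (1 / s)) * (A * μ (D i)) ^ ((t - 1) / s))) := by
          rw [show 1 - (t - 1) / s = (1 - t / s) + 1 / s by ring,
            ENNReal.rpow_add_of_nonneg _ _ (by linarith) (by positivity),
            ENNReal.ofReal_mul ht0.le]
          ring
        _ ≤ ENNReal.ofReal (t * (2 * s) ^ (t - 1)) * (ν (D i) ^ (1 - t / s) *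
            ((A * μ (D i)) ^ (1 / s) * (A * μ (D i)) ^ ((t - 1) / s))) := by
          gcongr
        _ = _ := by
          rw [← ENNReal.rpow_add_of_nonneg _ _ (by positivity)
            (div_nonneg (by linarith) hs0.le), h4]
          ring_nf
    refine (add_le_add h1 h2).trans ?_
    rw [← add_mul, ← ENNReal.ofReal_add (by positivity) (by positivity), ← mul_add]
    gcongr
    exact mul_le_of_le_one_right (by positivity) (two_rpow_neg_add_half_le hy0 hy1)

theorem lintegral_rpow_le_of_le (T : IsSparseTree μ D ch) [Countable ι] (hs : 1 ≤ s)
    (hA : ∀ i, l i ^ s * ν (D i) ≤ A * μ (D i)) (m : ℕ) :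
    ∀ {t : ℝ}, 0 ≤ t → t ≤ m + 1 → t ≤ s →
    ∀ N i, ∫⁻ x in D i, sparseSum D ch l N i x ^ t ∂ν ≤
      ENNReal.ofReal ((2 * s) ^ t) * (ν (D i) ^ (1 - t / s) * (A * μ (D i)) ^ (t / s)) := by
  have hs0 : 0 < s := by linarith
  induction m with
  | zero =>
    intro t ht0 ht1 hts N i
    have h1 := T.lintegral_rpow_step hs hA le_rfl hs
      (fun N i => by simp [ENNReal.rpow_zero]) N i
    simp only [ENNReal.rpow_one, Real.rpow_one] at h1
    simp only [Nat.cast_zero, zero_add] at ht1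
    have h2 := ENNReal.lintegral_mul_norm_pow_le (μ := ν.restrict (D i))
      (measurable_sparseSum (l := l) (ch := ch) T.measurableSet N i).aemeasurable
      (measurable_const (a := (1 : ℝ≥0∞))).aemeasurable ht0 (sub_nonneg.2 ht1) (by ring)
    simp only [ENNReal.one_rpow, mul_one, lintegral_const, one_mul, Measure.restrict_apply_univ]
      at h2
    refine h2.trans ?_
    have h3 : 0 ≤ 1 - 1 / s := by
      rw [sub_nonneg, div_le_one hs0]
      exact hs
    calc
      _ ≤ (ENNReal.ofReal (2 * s) * (ν (D i) ^ (1 - 1 / s) * (A * μ (D i)) ^ (1 / s))) ^ t *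
          ν (D i) ^ (1 - t) := by gcongr
      _ = _ := by
        rw [ENNReal.mul_rpow_of_nonneg _ _ ht0, ENNReal.mul_rpow_of_nonneg _ _ ht0,
          ENNReal.ofReal_rpow_of_nonneg (by positivity) ht0, ← ENNReal.rpow_mul,
          ← ENNReal.rpow_mul,
          show 1 - t / s = (1 - 1 / s) * t + (1 - t) by ring,
          ENNReal.rpow_add_of_nonneg _ _ (mul_nonneg h3 ht0) (sub_nonneg.2 ht1)]
        ring_nf
  | succ m ih =>
    intro t ht0 htm hts
    rcases le_total t 1 with h | h
    · exact ih ht0 (h.trans (by simp)) hts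
    · refine T.lintegral_rpow_step hs hA h hts (ih (by linarith) ?_ (by linarith))
      push_cast at htm
      linarith

theorem lintegral_rpow_le (T : IsSparseTree μ D ch) [Countable ι] (hs : 0 < s)
    (hA : ∀ i, l i ^ s * ν (D i) ≤ A * μ (D i)) (N : ℕ) (i : ι) :
    ∫⁻ x in D i, sparseSum D ch l N i x ^ s ∂ν ≤
      ENNReal.ofReal (max 2 ((2 * s) ^ s)) * (A * μ (D i)) := by
  rcases le_total 1 s with h1 | h1
  · have := T.lintegral_rpow_le_of_le h1 hA ⌈s⌉₊ hs.le
      ((Nat.le_ceil s).trans (by simp)) le_rfl N i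
    rw [div_self hs.ne', sub_self, ENNReal.rpow_zero, one_mul, ENNReal.rpow_one] at this
    refine this.trans ?_
    gcongr
    exact le_max_right _ _
  · suffices h : ∀ N i, ∫⁻ x in D i, sparseSum D ch l N i x ^ s ∂ν ≤ 2 * (A * μ (D i)) by
      refine (h N i).trans ?_
      gcongr
      rw [← ENNReal.ofReal_ofNat]
      exact ENNReal.ofReal_le_ofReal (le_max_left _ _)
    intro N
    induction N with
    | zero => intro i; simp [sparseSum, hs]
    | succ N ih =>
      intro i
      refine (T.lintegral_succ_le_of_le_one ν N i hs h1).trans ?_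
      calc
        _ ≤ (∑' j : ch i, 2 * (A * μ (D j))) + A * μ (D i) :=
          add_le_add (ENNReal.tsum_le_tsum fun j => ih j) (hA i)
        _ = A * (2 * ∑' j : ch i, μ (D j)) + A * μ (D i) := by
          rw [ENNReal.tsum_mul_left, ENNReal.tsum_mul_left]
          ring
        _ ≤ A * μ (D i) + A * μ (D i) := by
          gcongr
          exact T.half i
        _ = _ := (two_mul _).symm

theorem mul_measure_le (T : IsSparseTree μ D ch) [Countable ι] {M : X → ℝ≥0∞} (i : ι)
    (hM : ∀ x ∈ D i, l i ≤ M x) :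
    l i * μ (D i) + 2 * ∑' j : ch i, ∫⁻ x in D j, M x ∂μ ≤ 2 * ∫⁻ x in D i, M x ∂μ := by
  set U := ⋃ j : ch i, D j with hU
  have hUm : MeasurableSet U := MeasurableSet.iUnion fun j => T.measurableSet j
  have hUD : U ⊆ D i := iUnion_subset fun j => T.subset i j j.2
  have hd : Pairwise (Function.onFun Disjoint fun j : ch i => D j) :=
    fun j k hjk => T.disjoint i j.2 k.2 (Subtype.coe_ne_coe.2 hjk)
  rw [← lintegral_iUnion (fun j : ch i => T.measurableSet j) hd, ← hU]
  have h1 : ∫⁻ x in D i, M x ∂μ = ∫⁻ x in U, M x ∂μ + ∫⁻ x in D i \ U, M x ∂μ := by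
    rw [← lintegral_union ((T.measurableSet i).diff hUm) disjoint_sdiff_right,
      union_sdiff_cancel hUD]
  have h2 : l i * μ (D i \ U) ≤ ∫⁻ x in D i \ U, M x ∂μ := by
    rw [← setLIntegral_const]
    exact setLIntegral_mono' ((T.measurableSet i).diff hUm) fun x hx => hM x hx.1
  have h3 : μ (D i) ≤ 2 * μ (D i \ U) := by
    have hUhalf : 2 * μ U ≤ μ (D i) := by
      refine le_trans ?_ (T.half i)
      gcongr
      exact measure_iUnion_le _
    have hadd : μ (D i) = μ U + μ (D i \ U) := by
      rw [← measure_union disjoint_sdiff_right ((T.measurableSet i).diff hUm),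
        union_sdiff_cancel hUD]
    have hfin : 2 * μ U ≠ ∞ := ne_top_of_le_ne_top (T.measure_ne_top i) hUhalf
    refine (ENNReal.add_le_add_iff_left hfin).1 ?_
    calc 2 * μ U + μ (D i) ≤ μ (D i) + μ (D i) := by gcongr
      _ = 2 * μ (D i) := (two_mul _).symm
      _ = _ := by rw [hadd, mul_add]
  calc
    _ ≤ l i * (2 * μ (D i \ U)) + 2 * ∫⁻ x in U, M x ∂μ := by gcongr
    _ = 2 * (∫⁻ x in U, M x ∂μ + l i * μ (D i \ U)) := by ring
    _ ≤ _ := by rw [h1]; gcongr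

theorem lintegral_rpow_add_one_le (T : IsSparseTree μ D ch) [Countable ι] (hs : 0 < s)
    (hA : ∀ i, l i ^ s * ν (D i) ≤ A * μ (D i)) {M : X → ℝ≥0∞} {Q : Set X}
    (hM : ∀ i, D i ⊆ Q → ∀ x ∈ D i, l i ≤ M x) (N : ℕ) :
    ∀ i, D i ⊆ Q → ∫⁻ x in D i, sparseSum D ch l N i x ^ (s + 1) ∂ν ≤
      ENNReal.ofReal (s + 1) * ENNReal.ofReal (max 2 ((2 * s) ^ s)) * A *
        (2 * ∫⁻ x in D i, M x ∂μ) := by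
  set K := ENNReal.ofReal (max 2 ((2 * s) ^ s))
  induction N with
  | zero => intro i _; simp [sparseSum, (by linarith : 0 < s + 1)]
  | succ N ih =>
    intro i hi
    refine (T.lintegral_succ_le_of_one_le ν N i (by linarith)).trans ?_
    rw [add_sub_cancel_right]
    calc
      _ ≤ (∑' j : ch i, ENNReal.ofReal (s + 1) * K * A * (2 * ∫⁻ x in D j, M x ∂μ)) +
          ENNReal.ofReal (s + 1) * l i * (K * (A * μ (D i))) := by
        gcongr with j
        · exact ih j ((T.subset i j j.2).trans hi)
        · exact T.lintegral_rpow_le hs hA _ i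
      _ = ENNReal.ofReal (s + 1) * K * A *
          (l i * μ (D i) + 2 * ∑' j : ch i, ∫⁻ x in D j, M x ∂μ) := by
        rw [ENNReal.tsum_mul_left, ENNReal.tsum_mul_left]
        ring
      _ ≤ _ := by
        gcongr
        exact T.mul_measure_le i (hM i hi)

/-- A function dominated by the sparse sums off the exceptional generations inherits their
`L^{s+1}` bound. -/
theorem lintegral_rpow_le_of_dominated (T : IsSparseTree μ D ch) [Countable ι] (hs : 0 < s)
    (hνμ : ν ≪ μ)
    (hA : ∀ i, l i ^ s * ν (D i) ≤ A * μ (D i)) {M : X → ℝ≥0∞} {i : ι}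
    (hM : ∀ j, D j ⊆ D i → ∀ x ∈ D j, l j ≤ M x) {H : X → ℝ≥0∞} {C : ℝ≥0∞} (hC : C ≠ ∞)
    (hH : ∀ᵐ x ∂μ, ∀ N, x ∈ D i → x ∈ generation D ch N i ∨ H x ≤ C * sparseSum D ch l N i x) :
    ∫⁻ x in D i, H x ^ (s + 1) ∂ν ≤ C ^ (s + 1) *
      (ENNReal.ofReal (s + 1) * ENNReal.ofReal (max 2 ((2 * s) ^ s)) * A *
        (2 * ∫⁻ x in D i, M x ∂μ)) := by
  have hs1 : 0 ≤ s + 1 := by linarith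
  have hm := measurable_sparseSum (l := l) (ch := ch) T.measurableSet
  have hpt : ∀ᵐ x ∂ν.restrict (D i),
      H x ^ (s + 1) ≤ C ^ (s + 1) * ⨆ N, sparseSum D ch l N i x ^ (s + 1) := by
    rw [ae_restrict_iff' (T.measurableSet i)]
    have hnull : ∀ᵐ x ∂μ, x ∉ ⋂ N, generation D ch N i :=
      measure_eq_zero_iff_ae_notMem.1 (T.measure_iInter_generation i)
    filter_upwards [hνμ.ae_le hH, hνμ.ae_le hnull] with x hx hxn hxD
    rw [mem_iInter, not_forall] at hxn
    obtain ⟨N, hN⟩ := hxn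
    refine (ENNReal.rpow_le_rpow ((hx N hxD).resolve_left hN) hs1).trans ?_
    rw [ENNReal.mul_rpow_of_nonneg _ _ hs1]
    gcongr
    exact le_iSup (fun N => sparseSum D ch l N i x ^ (s + 1)) N
  refine (lintegral_mono_ae hpt).trans ?_
  rw [lintegral_const_mul' _ _ (ENNReal.rpow_ne_top_of_nonneg hs1 hC),
    lintegral_iSup (fun N => (hm N i).pow_const _) (monotone_nat_of_le_succ fun N x =>
      ENNReal.rpow_le_rpow (sparseSum_le_succ N i x) hs1)]
  gcongr
  exact iSup_le fun N => T.lintegral_rpow_add_one_le hs hA hM N i subset_rfl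

end IsSparseTree

end SparseTree

section Dyadic

variable {n : ℕ}

theorem Cube_eq_Icc (a : Fin n → ℝ) (h : ℝ) : Cube a h = Icc a (fun i => a i + h) :=
  pi_univ_Icc _ _

theorem Cube_eq_closedBall (a : Fin n → ℝ) {h : ℝ} (hh : 0 ≤ h) :
    Cube a h = Metric.closedBall (fun i => a i + h / 2) (h / 2) := by
  rw [closedBall_pi _ (by positivity), Cube]
  congr 1
  ext1 i
  rw [Real.closedBall_eq_Icc]
  ring_nf

theorem isCompact_Cube (a : Fin n → ℝ) (h : ℝ) : IsCompact (Cube a h) := by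
  rw [Cube_eq_Icc]
  exact isCompact_Icc

theorem volume_Cube (a : Fin n → ℝ) (h : ℝ) : volume (Cube a h) = ENNReal.ofReal h ^ n := by
  simp [Cube_eq_Icc, Real.volume_Icc_pi]

theorem volume_Cube_ne_zero (a : Fin n → ℝ) {h : ℝ} (hh : 0 < h) : volume (Cube a h) ≠ 0 := by
  rw [volume_Cube]
  exact pow_ne_zero _ (by simpa using hh)

theorem volume_Cube_ne_top (a : Fin n → ℝ) (h : ℝ) : volume (Cube a h) ≠ ∞ :=
  (isCompact_Cube a h).measure_lt_top.ne

/-- The lower corner of the dyadic subcube with index `P`. -/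
def dyadicCorner (a : Fin n → ℝ) (h : ℝ) (P : ℕ × (Fin n → ℤ)) : Fin n → ℝ :=
  fun i => a i + P.2 i * (h / 2 ^ P.1)

/-- The half-open dyadic cube with index `P`. -/
def dyadicCell (a : Fin n → ℝ) (h : ℝ) (P : ℕ × (Fin n → ℤ)) : Set (Fin n → ℝ) :=
  univ.pi fun i => Ico (dyadicCorner a h P i) (dyadicCorner a h P i + h / 2 ^ P.1)

/-- The index of the dyadic cube of generation `k` containing `x`. -/
def dyadicIndex (a : Fin n → ℝ) (h : ℝ) (k : ℕ) (x : Fin n → ℝ) : ℕ × (Fin n → ℤ) :=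
  (k, fun i => ⌊(x i - a i) / (h / 2 ^ k)⌋)

variable {a : Fin n → ℝ} {h : ℝ}

theorem mem_dyadicCell (hh : 0 < h) {P : ℕ × (Fin n → ℤ)} {x : Fin n → ℝ} :
    x ∈ dyadicCell a h P ↔ dyadicIndex a h P.1 x = P := by
  obtain ⟨k, m⟩ := P
  have hk : 0 < h / 2 ^ k := by positivity
  simp only [dyadicCell, dyadicCorner, mem_univ_pi, mem_Ico, dyadicIndex, Prod.mk.injEq, true_and,
    funext_iff]
  refine forall_congr' fun i => ?_
  rw [Int.floor_eq_iff, le_div_iff₀ hk, div_lt_iff₀ hk]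
  constructor <;> rintro ⟨h1, h2⟩ <;> constructor <;> linarith

theorem mem_dyadicCell_index (hh : 0 < h) (k : ℕ) (x : Fin n → ℝ) :
    x ∈ dyadicCell a h (dyadicIndex a h k x) :=
  (mem_dyadicCell hh).2 rfl

theorem dyadicIndex_congr {k l : ℕ} (hkl : k ≤ l) {x y : Fin n → ℝ}
    (hxy : dyadicIndex a h l x = dyadicIndex a h l y) :
    dyadicIndex a h k x = dyadicIndex a h k y := by
  simp only [dyadicIndex, Prod.mk.injEq, true_and, funext_iff] at hxy ⊢
  intro i
  have key : ∀ z : ℝ, z / (h / 2 ^ k) = z / (h / 2 ^ l) / ((2 ^ (l - k) : ℕ) : ℝ) := fun z => by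
    obtain ⟨d, rfl⟩ := Nat.exists_eq_add_of_le hkl
    rw [Nat.add_sub_cancel_left, pow_add]
    push_cast
    field_simp
  rw [key, key, Int.floor_div_natCast, Int.floor_div_natCast, hxy i]

theorem dyadicCell_subset (hh : 0 < h) {P R : ℕ × (Fin n → ℤ)} (hPR : P.1 ≤ R.1) {x : Fin n → ℝ}
    (hP : x ∈ dyadicCell a h P) (hR : x ∈ dyadicCell a h R) :
    dyadicCell a h R ⊆ dyadicCell a h P := fun y hy => by
  rw [mem_dyadicCell hh] at hP hR hy ⊢
  rw [← hP]
  exact dyadicIndex_congr hPR (hy.trans hR.symm)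

theorem dyadicCell_nonempty (hh : 0 < h) (P : ℕ × (Fin n → ℤ)) : (dyadicCell a h P).Nonempty :=
  ⟨dyadicCorner a h P, fun i _ => left_mem_Ico.2 (by
    have : 0 < h / 2 ^ P.1 := by positivity
    linarith)⟩

theorem measurableSet_dyadicCell (P : ℕ × (Fin n → ℤ)) : MeasurableSet (dyadicCell a h P) :=
  MeasurableSet.univ_pi fun _ => measurableSet_Ico

theorem dyadicCell_subset_Cube (P : ℕ × (Fin n → ℤ)) :
    dyadicCell a h P ⊆ Cube (dyadicCorner a h P) (h / 2 ^ P.1) :=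
  pi_mono fun _ _ => Ico_subset_Icc_self

theorem dyadicCell_ae_eq (P : ℕ × (Fin n → ℤ)) :
    dyadicCell a h P =ᵐ[volume] Cube (dyadicCorner a h P) (h / 2 ^ P.1) := by
  rw [Cube_eq_Icc]
  exact Measure.univ_pi_Ico_ae_eq_Icc

theorem volume_dyadicCell (P : ℕ × (Fin n → ℤ)) :
    volume (dyadicCell a h P) = ENNReal.ofReal (h / 2 ^ P.1) ^ n := by
  rw [measure_congr (dyadicCell_ae_eq P), volume_Cube]

theorem volume_dyadicCell_ne_zero (hh : 0 < h) (P : ℕ × (Fin n → ℤ)) :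
    volume (dyadicCell a h P) ≠ 0 := by
  rw [measure_congr (dyadicCell_ae_eq P)]
  exact volume_Cube_ne_zero _ (by positivity)

theorem volume_dyadicCell_ne_top (P : ℕ × (Fin n → ℤ)) : volume (dyadicCell a h P) ≠ ∞ := by
  rw [measure_congr (dyadicCell_ae_eq P)]
  exact volume_Cube_ne_top _ _

theorem volume_dyadicCell_succ {P R : ℕ × (Fin n → ℤ)} (hPR : R.1 = P.1 + 1) :
    volume (dyadicCell a h P) = 2 ^ n * volume (dyadicCell a h R) := by
  rw [volume_dyadicCell, volume_dyadicCell, hPR, ← mul_pow, ← ENNReal.ofReal_ofNat,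
    ← ENNReal.ofReal_mul (by norm_num)]
  congr 2
  rw [pow_succ]
  field_simp

/-- The average over the dyadic cube `R` of the distance of `b` to its average over `P`. -/
def dyadicOsc (a : Fin n → ℝ) (h : ℝ) (b : (Fin n → ℝ) → ℝ) (P R : ℕ × (Fin n → ℤ)) : ℝ≥0∞ :=
  (∫⁻ x in dyadicCell a h R,
    ENNReal.ofReal |b x - cubeAvg (dyadicCorner a h P) (h / 2 ^ P.1) b|) /
      volume (dyadicCell a h R)

/-- The maximal dyadic subcubes of `P` on which `b` is on average far from its average over `P`. -/
def stoppingChildren (a : Fin n → ℝ) (h : ℝ) (b : (Fin n → ℝ) → ℝ) (P : ℕ × (Fin n → ℤ)) :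
    Set (ℕ × (Fin n → ℤ)) :=
  {R | P.1 < R.1 ∧ dyadicCell a h R ⊆ dyadicCell a h P ∧
    2 * dyadicOsc a h b P P < dyadicOsc a h b P R ∧
    ∀ S : ℕ × (Fin n → ℤ), P.1 ≤ S.1 → S.1 < R.1 → dyadicCell a h R ⊆ dyadicCell a h S →
      dyadicOsc a h b P S ≤ 2 * dyadicOsc a h b P P}

variable {b : (Fin n → ℝ) → ℝ}

theorem dyadicOsc_eq (P R : ℕ × (Fin n → ℤ)) : dyadicOsc a h b P R =
    (∫⁻ x in Cube (dyadicCorner a h R) (h / 2 ^ R.1),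
      ENNReal.ofReal |b x - cubeAvg (dyadicCorner a h P) (h / 2 ^ P.1) b|) /
        volume (Cube (dyadicCorner a h R) (h / 2 ^ R.1)) := by
  rw [dyadicOsc, measure_congr (dyadicCell_ae_eq R), setLIntegral_congr (dyadicCell_ae_eq R)]

theorem dyadicOsc_mul_volume (hh : 0 < h) (P R : ℕ × (Fin n → ℤ)) :
    dyadicOsc a h b P R * volume (dyadicCell a h R) = ∫⁻ x in dyadicCell a h R,
      ENNReal.ofReal |b x - cubeAvg (dyadicCorner a h P) (h / 2 ^ P.1) b| :=
  ENNReal.div_mul_cancel (volume_dyadicCell_ne_zero hh R) (volume_dyadicCell_ne_top R)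

theorem integrableOn_Cube (hb : LocallyIntegrable b volume) (c : Fin n → ℝ) (r : ℝ) :
    IntegrableOn b (Cube c r) volume :=
  hb.integrableOn_isCompact (isCompact_Cube c r)

theorem integrableOn_abs_sub_const (hb : LocallyIntegrable b volume) (m : ℝ) (c : Fin n → ℝ)
    (r : ℝ) : IntegrableOn (fun x => |b x - m|) (Cube c r) volume :=
  ((integrableOn_Cube hb c r).sub (integrableOn_const (volume_Cube_ne_top c r))).abs

theorem dyadicOsc_eq_ofReal (hb : LocallyIntegrable b volume)
    (P R : ℕ × (Fin n → ℤ)) : dyadicOsc a h b P R =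
      ENNReal.ofReal (⨍ x in Cube (dyadicCorner a h R) (h / 2 ^ R.1),
        |b x - cubeAvg (dyadicCorner a h P) (h / 2 ^ P.1) b|) := by
  rw [dyadicOsc_eq, ofReal_setAverage (integrableOn_abs_sub_const hb _ _ _)
    (Filter.Eventually.of_forall fun _ => abs_nonneg _)]

theorem ofReal_abs_cubeAvg_sub_le (hh : 0 < h) (hb : LocallyIntegrable b volume)
    (P R : ℕ × (Fin n → ℤ)) :
    ENNReal.ofReal |cubeAvg (dyadicCorner a h R) (h / 2 ^ R.1) b -
      cubeAvg (dyadicCorner a h P) (h / 2 ^ P.1) b| ≤ dyadicOsc a h b P R := by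
  rw [dyadicOsc_eq_ofReal hb]
  refine ENNReal.ofReal_le_ofReal ?_
  generalize cubeAvg (dyadicCorner a h P) (h / 2 ^ P.1) b = m
  set Q := Cube (dyadicCorner a h R) (h / 2 ^ R.1) with hQ
  have h0 : volume.real Q ≠ 0 := by
    rw [measureReal_def, ENNReal.toReal_ne_zero]
    exact ⟨volume_Cube_ne_zero _ (by positivity), volume_Cube_ne_top _ _⟩
  have h1 : cubeAvg (dyadicCorner a h R) (h / 2 ^ R.1) b - m = ⨍ x in Q, (b x - m) := by
    rw [cubeAvg, ← hQ, setAverage_eq, setAverage_eq,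
      integral_sub (integrableOn_Cube hb _ _) (integrableOn_const (volume_Cube_ne_top _ _)),
      setIntegral_const]
    rw [smul_eq_mul, smul_eq_mul, smul_eq_mul, mul_sub, inv_mul_cancel_left₀ h0]
  rw [h1, average, average]
  exact norm_integral_le_integral_norm (fun x => b x - m)

theorem pairwiseDisjoint_stoppingChildren (hh : 0 < h) (P : ℕ × (Fin n → ℤ)) :
    (stoppingChildren a h b P).PairwiseDisjoint (dyadicCell a h) := by
  intro R hR S hS hne
  rw [Function.onFun, disjoint_left]
  intro x hxR hxS
  rcases lt_trichotomy R.1 S.1 with hlt | heq | hlt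
  · exact (hS.2.2.2 R hR.1.le hlt (dyadicCell_subset hh hlt.le hxR hxS)).not_gt hR.2.2.1
  · rw [mem_dyadicCell hh] at hxR hxS
    exact hne (hxR.symm.trans ((congrArg (dyadicIndex a h · x) heq).trans hxS))
  · exact (hR.2.2.2 S hS.1.le hlt (dyadicCell_subset hh hlt.le hxS hxR)).not_gt hS.2.2.1

theorem isSparseTree_stoppingChildren (hh : 0 < h) (hb : LocallyIntegrable b volume) :
    IsSparseTree volume (dyadicCell a h) (stoppingChildren a h b) where
  measurableSet := measurableSet_dyadicCell
  measure_ne_top := volume_dyadicCell_ne_top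
  disjoint P := pairwiseDisjoint_stoppingChildren hh P
  subset _ _ hR := hR.2.1
  half P := by
    have hd : Pairwise (Function.onFun Disjoint
        fun R : stoppingChildren a h b P => dyadicCell a h R) := fun R S hne =>
      pairwiseDisjoint_stoppingChildren hh P R.2 S.2 (Subtype.coe_ne_coe.2 hne)
    have key : dyadicOsc a h b P P *
        (2 * ∑' R : stoppingChildren a h b P, volume (dyadicCell a h R)) ≤
          dyadicOsc a h b P P * volume (dyadicCell a h P) := calc
      _ = ∑' R : stoppingChildren a h b P,
          2 * dyadicOsc a h b P P * volume (dyadicCell a h R) := by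
        rw [ENNReal.tsum_mul_left]
        ring
      _ ≤ ∑' R : stoppingChildren a h b P, ∫⁻ x in dyadicCell a h R,
          ENNReal.ofReal |b x - cubeAvg (dyadicCorner a h P) (h / 2 ^ P.1) b| := by
        refine ENNReal.tsum_le_tsum fun R => ?_
        rw [← dyadicOsc_mul_volume hh]
        gcongr
        exact R.2.2.2.1.le
      _ = ∫⁻ x in ⋃ R : stoppingChildren a h b P, dyadicCell a h R,
          ENNReal.ofReal |b x - cubeAvg (dyadicCorner a h P) (h / 2 ^ P.1) b| :=
        (lintegral_iUnion (fun R : stoppingChildren a h b P =>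
          measurableSet_dyadicCell R.1) hd _).symm
      _ ≤ _ := by
        rw [dyadicOsc_mul_volume hh]
        exact lintegral_mono_set (iUnion_subset fun R => R.2.2.1)
    by_cases h0 : dyadicOsc a h b P P = 0
    · have he : stoppingChildren a h b P = ∅ := by
        refine eq_empty_of_forall_notMem fun R hR => ?_
        have h1 := hR.2.2.1
        rw [h0, mul_zero] at h1
        have h2 : dyadicOsc a h b P R * volume (dyadicCell a h R) = 0 := ?_
        · exact h1.ne' ((mul_eq_zero.1 h2).resolve_right (volume_dyadicCell_ne_zero hh R))
        rw [dyadicOsc_mul_volume hh]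
        refine le_antisymm ((lintegral_mono_set hR.2.1).trans ?_) zero_le
        rw [← dyadicOsc_mul_volume hh, h0, zero_mul]
      simp [he]
    · refine (ENNReal.mul_le_mul_iff_right h0 ?_).1 key
      rw [dyadicOsc_eq_ofReal hb]
      exact ENNReal.ofReal_ne_top

theorem dyadicOsc_child_le (hh : 0 < h) {P R : ℕ × (Fin n → ℤ)}
    (hR : R ∈ stoppingChildren a h b P) :
    dyadicOsc a h b P R ≤ 2 ^ (n + 1) * dyadicOsc a h b P P := by
  obtain ⟨x, hx⟩ := dyadicCell_nonempty (a := a) hh R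
  obtain ⟨k, hk⟩ := Nat.exists_eq_add_of_lt hR.1
  set S := dyadicIndex a h (P.1 + k) x
  have hS1 : R.1 = S.1 + 1 := hk
  have hxS : x ∈ dyadicCell a h S := mem_dyadicCell_index hh _ x
  have hRS := dyadicCell_subset hh (by omega : S.1 ≤ R.1) hxS hx
  have h1 := hR.2.2.2 S (Nat.le_add_right _ _) (by omega) hRS
  calc
    _ ≤ 2 ^ n * dyadicOsc a h b P S := by
      rw [dyadicOsc]
      refine ENNReal.div_le_of_le_mul ?_
      rw [mul_right_comm, ← volume_dyadicCell_succ hS1, mul_comm, dyadicOsc_mul_volume hh]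
      exact lintegral_mono_set hRS
    _ ≤ 2 ^ n * (2 * dyadicOsc a h b P P) := by gcongr
    _ = _ := by rw [← mul_assoc, pow_succ]

theorem ae_tendsto_dyadicOsc (hh : 0 < h) (hb : LocallyIntegrable b volume)
    (P : ℕ × (Fin n → ℤ)) :
    ∀ᵐ x, Filter.Tendsto (fun k => dyadicOsc a h b P (dyadicIndex a h k x)) Filter.atTop
      (nhds (ENNReal.ofReal |b x - cubeAvg (dyadicCorner a h P) (h / 2 ^ P.1) b|)) := by
  have hf : LocallyIntegrable
      (fun x => |b x - cubeAvg (dyadicCorner a h P) (h / 2 ^ P.1) b|) volume := fun x =>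
    (hb.sub (locallyIntegrable_const _) x).norm
  filter_upwards [IsUnifLocDoublingMeasure.ae_tendsto_average volume hf 1] with x hx
  simp_rw [dyadicOsc_eq_ofReal hb]
  refine ENNReal.tendsto_ofReal ?_
  have hδ : ∀ k : ℕ, 0 < h / 2 ^ k := fun k => by positivity
  have := hx (fun k => fun i => dyadicCorner a h (dyadicIndex a h k x) i + h / 2 ^ k / 2)
    (fun k : ℕ => h / 2 ^ k / 2) (l := Filter.atTop) ?_ ?_
  · refine this.congr fun k => ?_
    rw [← Cube_eq_closedBall _ (hδ k).le]
    rfl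
  · refine tendsto_nhdsWithin_iff.2 ⟨?_, Filter.Eventually.of_forall fun k => half_pos (hδ k)⟩
    have h1 : Filter.Tendsto (fun k : ℕ => h / 2 * (1 / 2 : ℝ) ^ k) Filter.atTop
        (nhds (h / 2 * 0)) :=
      (_root_.tendsto_pow_atTop_nhds_zero_of_lt_one (by norm_num) (by norm_num)).const_mul _
    rw [mul_zero] at h1
    refine h1.congr fun k => ?_
    rw [one_div, inv_pow]
    field_simp
  · refine Filter.Eventually.of_forall fun k => ?_
    rw [one_mul, ← Cube_eq_closedBall _ (hδ k).le]
    exact dyadicCell_subset_Cube (dyadicIndex a h k x) (mem_dyadicCell_index hh k x)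

theorem exists_stoppingChild (hh : 0 < h) {P : ℕ × (Fin n → ℤ)} {x : Fin n → ℝ}
    (hx : x ∈ dyadicCell a h P) {k : ℕ} (hk : P.1 ≤ k)
    (hbad : 2 * dyadicOsc a h b P P < dyadicOsc a h b P (dyadicIndex a h k x)) :
    ∃ R ∈ stoppingChildren a h b P, x ∈ dyadicCell a h R := by
  classical
  have hex : ∃ k, P.1 ≤ k ∧
      2 * dyadicOsc a h b P P < dyadicOsc a h b P (dyadicIndex a h k x) := ⟨k, hk, hbad⟩
  obtain ⟨h1, h2⟩ := Nat.find_spec hex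
  have h3 := @Nat.find_min _ _ hex
  set l := Nat.find hex
  have hxl := mem_dyadicCell_index (a := a) hh l x
  refine ⟨dyadicIndex a h l x, ⟨?_, dyadicCell_subset hh h1 hx hxl, h2, ?_⟩, hxl⟩
  · refine lt_of_le_of_ne h1 fun he => ?_
    have hl : P.1 = l := he
    rw [← hl, (mem_dyadicCell hh).1 hx] at h2
    exact h2.not_ge (le_mul_of_one_le_left zero_le one_le_two)
  · intro S hPS hSl hsub
    have hS := (mem_dyadicCell hh).1 (hsub hxl)
    have := h3 hSl
    rw [hS] at this
    exact not_lt.1 fun hlt => this ⟨hPS, hlt⟩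

/-- Sparse domination of the oscillation of `b`. -/
theorem ae_abs_sub_cubeAvg_le (hh : 0 < h) (hb : LocallyIntegrable b volume) {B : ℝ≥0∞}
    {l : ℕ × (Fin n → ℤ) → ℝ≥0∞} (hl : ∀ P, dyadicOsc a h b P P ≤ B * l P) :
    ∀ᵐ x, ∀ N P, x ∈ dyadicCell a h P →
      x ∈ generation (dyadicCell a h) (stoppingChildren a h b) N P ∨
      ENNReal.ofReal |b x - cubeAvg (dyadicCorner a h P) (h / 2 ^ P.1) b| ≤
        2 ^ (n + 1) * B * sparseSum (dyadicCell a h) (stoppingChildren a h b) l N P x := by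
  filter_upwards [ae_all_iff.2 fun P => ae_tendsto_dyadicOsc (a := a) hh hb P] with x hx N
  induction N with
  | zero => exact fun P hP => Or.inl hP
  | succ N ih =>
    intro P hP
    rw [sparseSum, indicator_of_mem hP, mul_add]
    by_cases hc : ∃ R ∈ stoppingChildren a h b P, x ∈ dyadicCell a h R
    · obtain ⟨R, hR, hxR⟩ := hc
      rcases ih R hxR with h1 | h1
      · exact Or.inl (mem_iUnion.2 ⟨⟨R, hR⟩, h1⟩)
      · right
        have h2 := (ofReal_abs_cubeAvg_sub_le hh hb P R).trans (dyadicOsc_child_le hh hR)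
        refine (ENNReal.ofReal_le_ofReal (abs_sub_le _
          (cubeAvg (dyadicCorner a h R) (h / 2 ^ R.1) b) _)).trans ?_
        rw [ENNReal.ofReal_add (abs_nonneg _) (abs_nonneg _), add_comm]
        refine add_le_add (h2.trans ?_) (h1.trans ?_)
        · rw [mul_assoc]
          gcongr
          exact hl P
        · gcongr
          exact ENNReal.le_tsum (f := fun R : stoppingChildren a h b P =>
            sparseSum (dyadicCell a h) (stoppingChildren a h b) l N R x) ⟨R, hR⟩
    · right
      refine le_add_right ?_
      refine (le_of_tendsto (hx P) (Filter.eventually_atTop.2 ⟨P.1, fun k hk =>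
        not_lt.1 fun hlt => hc (exists_stoppingChild hh hP hk hlt)⟩)).trans ?_
      rw [mul_assoc, pow_succ', mul_assoc]
      gcongr
      refine (hl P).trans (le_mul_of_one_le_left zero_le ?_)
      exact one_le_pow₀ one_le_two

end Dyadic

section Weights

variable {n : ℕ} {a : Fin n → ℝ} {h : ℝ} {w b : (Fin n → ℝ) → ℝ}

theorem wInt_ne_top (hw : LocallyIntegrable w volume) (a : Fin n → ℝ) (h : ℝ) :
    wInt w a h ≠ ∞ :=
  (integrableOn_Cube hw a h).lintegral_lt_top.ne

theorem lintegral_abs_sub_cubeAvg_le (hw : LocallyIntegrable w volume)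
    (hB : bmoVY (fun _ => (1 : ℝ)) (wInt w) b ≠ ∞) (a : Fin n → ℝ) (hh : 0 < h) :
    ∫⁻ x in Cube a h, ENNReal.ofReal |b x - cubeAvg a h b| ≤
      bmoVY (fun _ => (1 : ℝ)) (wInt w) b * wInt w a h := by
  rw [← ENNReal.div_le_iff_le_mul (Or.inr hB) (Or.inl (wInt_ne_top hw a h))]
  have := le_iSup₂_of_le (f := fun (a : Fin n → ℝ) (h : ℝ) => ⨆ _ : 0 < h,
    (∫⁻ x in Cube a h, ENNReal.ofReal (|b x - cubeAvg a h b| * 1)) / wInt w a h) a h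
      (le_iSup_of_le hh le_rfl)
  simpa only [mul_one, bmoVY] using this

theorem dyadicOsc_self_le (hh : 0 < h) (hw : LocallyIntegrable w volume)
    (hB : bmoVY (fun _ => (1 : ℝ)) (wInt w) b ≠ ∞) (P : ℕ × (Fin n → ℤ)) :
    dyadicOsc a h b P P ≤ bmoVY (fun _ => (1 : ℝ)) (wInt w) b *
      (wInt w (dyadicCorner a h P) (h / 2 ^ P.1) /
        volume (Cube (dyadicCorner a h P) (h / 2 ^ P.1))) := by
  rw [dyadicOsc_eq, ← mul_div_assoc]
  gcongr
  exact lintegral_abs_sub_cubeAvg_le hw hB _ (by positivity)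

theorem lintegral_maxFn_le (hw : LocallyIntegrable w volume) (hh : 0 < h)
    (h0 : wInt w a h ≠ 0) :
    ∫⁻ x in Cube a h, maxFn ((Cube a h).indicator w) x ≤ fwConst w * wInt w a h := by
  rw [← ENNReal.div_le_iff_le_mul (Or.inl h0) (Or.inl (wInt_ne_top hw a h))]
  exact le_iSup₂_of_le (f := fun (a : Fin n → ℝ) (h : ℝ) => ⨆ _ : 0 < h,
    (∫⁻ x in Cube a h, maxFn ((Cube a h).indicator w) x) / wInt w a h) a h
      (le_iSup_of_le hh le_rfl)

theorem average_le_maxFn (hw : ∀ x, 0 ≤ w x) {c : Fin n → ℝ} {r : ℝ} (hr : 0 < r)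
    (hsub : Cube c r ⊆ Cube a h) {x : Fin n → ℝ} (hx : x ∈ Cube c r) :
    wInt w c r / volume (Cube c r) ≤ maxFn ((Cube a h).indicator w) x := by
  have h1 : wInt w c r = ∫⁻ y in Cube c r, ENNReal.ofReal |(Cube a h).indicator w y| :=
    setLIntegral_congr_fun (isCompact_Cube c r).measurableSet fun y hy => by
      simp only [indicator_of_mem (hsub hy), abs_of_nonneg (hw y)]
  rw [h1]
  exact le_iSup₂_of_le (f := fun (c : Fin n → ℝ) (r : ℝ) => ⨆ (_ : 0 < r) (_ : x ∈ Cube c r),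
    (∫⁻ y in Cube c r, ENNReal.ofReal |(Cube a h).indicator w y|) / volume (Cube c r)) c r
      (le_iSup₂_of_le hr hx le_rfl)

theorem closure_dyadicCell (hh : 0 < h) (P : ℕ × (Fin n → ℤ)) :
    closure (dyadicCell a h P) = Cube (dyadicCorner a h P) (h / 2 ^ P.1) := by
  have hk : 0 < h / 2 ^ P.1 := by positivity
  rw [dyadicCell, closure_pi_set, Cube]
  congr 1
  ext1 i
  exact closure_Ico (by linarith)

theorem Cube_dyadicCorner_subset (hh : 0 < h) {P R : ℕ × (Fin n → ℤ)}
    (hsub : dyadicCell a h R ⊆ dyadicCell a h P) :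
    Cube (dyadicCorner a h R) (h / 2 ^ R.1) ⊆ Cube (dyadicCorner a h P) (h / 2 ^ P.1) := by
  rw [← closure_dyadicCell hh, ← closure_dyadicCell hh]
  exact closure_mono hsub

theorem average_rpow_mul_dual_le {p : ℝ} (hp : 1 < p) (c : Fin n → ℝ) {r : ℝ} (hr : 0 < r) :
    (wInt w c r / volume (Cube c r)) ^ (1 / (p - 1)) *
      ∫⁻ x in Cube c r, ENNReal.ofReal (w x) ^ (1 - p / (p - 1)) ≤
        apConst p w ^ (1 / (p - 1)) * volume (Cube c r) := by
  have hp' : 0 < p - 1 := by linarith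
  have h1 := le_iSup₂_of_le (f := fun (c : Fin n → ℝ) (r : ℝ) => ⨆ _ : 0 < r,
    (wInt w c r / volume (Cube c r)) * ((∫⁻ x in Cube c r,
      ENNReal.ofReal (w x) ^ (1 - p / (p - 1))) / volume (Cube c r)) ^ (p - 1)) c r
      (le_iSup_of_le hr le_rfl)
  have h2 := ENNReal.rpow_le_rpow h1 (one_div_pos.2 hp').le
  rw [ENNReal.mul_rpow_of_nonneg _ _ (one_div_pos.2 hp').le, ← ENNReal.rpow_mul,
    mul_one_div_cancel hp'.ne', ENNReal.rpow_one, ← mul_div_assoc] at h2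
  exact (ENNReal.div_le_iff_le_mul (Or.inl (volume_Cube_ne_zero c hr))
    (Or.inl (volume_Cube_ne_top c r))).1 h2

theorem ofReal_abs_div_rpow_mul_le {q : ℝ} (hq : 0 < q) (u : ℝ) {v : ℝ} (hv : 0 ≤ v) :
    ENNReal.ofReal (|u / v| ^ q * v) ≤
      ENNReal.ofReal v ^ (1 - q) * ENNReal.ofReal |u| ^ q := by
  rcases hv.eq_or_lt with rfl | hv
  · simp
  · rw [ENNReal.ofReal_rpow_of_pos hv, ENNReal.ofReal_rpow_of_nonneg (abs_nonneg _) hq.le,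
      ← ENNReal.ofReal_mul (by positivity), abs_div, abs_of_pos hv,
      Real.div_rpow (abs_nonneg _) hv.le, Real.rpow_sub hv, Real.rpow_one]
    refine ENNReal.ofReal_le_ofReal (le_of_eq ?_)
    ring

theorem mul_max_le_rpow {q : ℝ} (hq : 1 < q) :
    2 * (q * max 2 ((2 * (q - 1)) ^ (q - 1))) ≤ (4 * q) ^ q := by
  rw [mul_max_of_nonneg _ _ (by linarith), mul_max_of_nonneg _ _ (by norm_num)]
  refine max_le ?_ ?_
  · calc 2 * (q * 2) = (4 * q) ^ (1 : ℝ) := by rw [Real.rpow_one]; ring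
      _ ≤ _ := Real.rpow_le_rpow_of_exponent_le (by linarith) hq.le
  · calc 2 * (q * (2 * (q - 1)) ^ (q - 1)) = (2 * q) * (2 * (q - 1)) ^ (q - 1) := by ring
      _ ≤ (4 * q) * (4 * q) ^ (q - 1) := by
        gcongr <;> linarith
      _ = _ := by rw [← Real.rpow_one_add' (by linarith) (by linarith)]; congr 1; ring

/-- The bound of the weighted oscillation of `b` before normalization. -/
theorem lintegral_rpow_osc_le {p : ℝ} (hp : 1 < p) (hw : IsWeight w)
    (hb : LocallyIntegrable b volume) (hB : bmoVY (fun _ => (1 : ℝ)) (wInt w) b ≠ ∞)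
    (a : Fin n → ℝ) (hh : 0 < h) :
    ∫⁻ x in Cube a h,
        ENNReal.ofReal (|(b x - cubeAvg a h b) / w x| ^ (p / (p - 1)) * w x) ≤
      (2 ^ (n + 1) * bmoVY (fun _ => (1 : ℝ)) (wInt w) b) ^ (p / (p - 1)) *
        (ENNReal.ofReal (4 * (p / (p - 1))) ^ (p / (p - 1)) * apConst p w ^ (1 / (p - 1)) *
          ∫⁻ x in Cube a h, maxFn ((Cube a h).indicator w) x) := by
  have hp' : 0 < p - 1 := by linarith
  have hs : 0 < 1 / (p - 1) := one_div_pos.2 hp'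
  have hqs : p / (p - 1) = 1 / (p - 1) + 1 := by field_simp; ring
  have hq1 : 1 < p / (p - 1) := by linarith
  set B := bmoVY (fun _ => (1 : ℝ)) (wInt w) b
  let l : ℕ × (Fin n → ℤ) → ℝ≥0∞ := fun P =>
    wInt w (dyadicCorner a h P) (h / 2 ^ P.1) /
      volume (Cube (dyadicCorner a h P) (h / 2 ^ P.1))
  let g : (Fin n → ℝ) → ℝ≥0∞ := fun x => ENNReal.ofReal (w x) ^ (1 - p / (p - 1))
  have hg : AEMeasurable g volume :=
    hw.2.aestronglyMeasurable.aemeasurable.ennreal_ofReal.pow_const _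
  have hc0 : dyadicCorner a h (0, 0) = a := by ext i; simp [dyadicCorner]
  have hh0 : h / 2 ^ ((0, 0) : ℕ × (Fin n → ℤ)).1 = h := by simp
  have hae : dyadicCell a h (0, 0) =ᵐ[volume] Cube a h := by
    have := dyadicCell_ae_eq (a := a) (h := h) (0, 0)
    rwa [hc0, hh0] at this
  have hA : ∀ P, l P ^ (1 / (p - 1)) * volume.withDensity g (dyadicCell a h P) ≤
      apConst p w ^ (1 / (p - 1)) * volume (dyadicCell a h P) := fun P => by
    rw [withDensity_apply _ (measurableSet_dyadicCell P), setLIntegral_congr (dyadicCell_ae_eq P),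
      measure_congr (dyadicCell_ae_eq P)]
    exact average_rpow_mul_dual_le hp _ (by positivity)
  have hM : ∀ P, dyadicCell a h P ⊆ dyadicCell a h (0, 0) → ∀ x ∈ dyadicCell a h P,
      l P ≤ maxFn ((Cube a h).indicator w) x := fun P hP x hx => by
    have hsub := Cube_dyadicCorner_subset hh hP
    rw [hc0, hh0] at hsub
    exact average_le_maxFn hw.1 (by positivity) hsub (dyadicCell_subset_Cube P hx)
  have hH : ∀ᵐ x, ∀ N, x ∈ dyadicCell a h (0, 0) →
      x ∈ generation (dyadicCell a h) (stoppingChildren a h b) N (0, 0) ∨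
      ENNReal.ofReal |b x - cubeAvg a h b| ≤ 2 ^ (n + 1) * B *
        sparseSum (dyadicCell a h) (stoppingChildren a h b) l N (0, 0) x := by
    filter_upwards [ae_abs_sub_cubeAvg_le (a := a) hh hb fun P => dyadicOsc_self_le hh hw.2 hB P]
      with x hx N hxP
    have := hx N (0, 0) hxP
    rwa [hc0, hh0] at this
  have hmain := (isSparseTree_stoppingChildren hh hb).lintegral_rpow_le_of_dominated hs
    (withDensity_absolutelyContinuous _ _) hA hM (C := 2 ^ (n + 1) * B)
    (ENNReal.mul_ne_top (by simp) hB) hH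
  have hHm : AEMeasurable (fun x => ENNReal.ofReal |b x - cubeAvg a h b| ^ (p / (p - 1)))
      volume :=
    ((hb.aestronglyMeasurable.aemeasurable.sub_const _).norm.ennreal_ofReal).pow_const _
  rw [← hqs, restrict_withDensity (measurableSet_dyadicCell _),
    lintegral_withDensity_eq_lintegral_mul₀ hg.restrict hHm.restrict,
    setLIntegral_congr hae, setLIntegral_congr hae] at hmain
  refine (lintegral_mono fun x =>
    ofReal_abs_div_rpow_mul_le (by linarith) _ (hw.1 x)).trans (hmain.trans (mul_le_mul' le_rfl ?_))
  have h2 := ENNReal.ofReal_le_ofReal (mul_max_le_rpow hq1)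
  rw [ENNReal.ofReal_mul (by norm_num), ENNReal.ofReal_mul (by linarith),
    ← ENNReal.ofReal_rpow_of_nonneg (by linarith) (by linarith), ENNReal.ofReal_ofNat,
    show p / (p - 1) - 1 = 1 / (p - 1) by linarith] at h2
  calc _ = 2 * (ENNReal.ofReal (p / (p - 1)) *
        ENNReal.ofReal (max 2 ((2 * (1 / (p - 1))) ^ (1 / (p - 1))))) *
        apConst p w ^ (1 / (p - 1)) *
          ∫⁻ x in Cube a h, maxFn ((Cube a h).indicator w) x := by ring
    _ ≤ _ := by gcongr

end Weights

/-- for `1 < p < ∞`, `w ∈ A_p` and `b ∈ BMO_{1,w}`, for every cube `Q`,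
`((1/w(Q)) ∫_Q |(b - b_Q)/w|^{p'} w)^{1/p'} ≤ c_n p' ‖b‖_{BMO_{1,w}} [w]_{A_p}^{1/p} [w]_{A∞}^{1/p'}`. -/
theorem stmt5 (n : ℕ) :
    ∃ c : ℝ, 0 < c ∧
      ∀ (p : ℝ), 1 < p →
      ∀ (w b : (Fin n → ℝ) → ℝ), IsWeight w → apConst p w < ⊤ →
        LocallyIntegrable b volume → bmoVY (fun _ => (1 : ℝ)) (wInt w) b < ⊤ →
        ∀ (a : Fin n → ℝ) (h : ℝ), 0 < h →
          ((∫⁻ x in Cube a h,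
              ENNReal.ofReal (|(b x - cubeAvg a h b) / w x| ^ (p / (p - 1)) * w x)) /
                wInt w a h) ^ ((p - 1) / p)
            ≤ ENNReal.ofReal (c * (p / (p - 1))) * bmoVY (fun _ => (1 : ℝ)) (wInt w) b *
                apConst p w ^ (1 / p) * fwConst w ^ ((p - 1) / p) := by
  refine ⟨2 ^ (n + 3), by positivity, fun p hp w b hw _ hb hB a h hh => ?_⟩
  have hp' : 0 < p - 1 := by linarith
  have hr : 0 < (p - 1) / p := by positivity
  have hqr : p / (p - 1) * ((p - 1) / p) = 1 := by field_simp
  by_cases h0 : wInt w a h = 0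
  · have hz : ∫⁻ x in Cube a h,
        ENNReal.ofReal (|(b x - cubeAvg a h b) / w x| ^ (p / (p - 1)) * w x) = 0 := by
      have h1 := (lintegral_eq_zero_iff'
        hw.2.aestronglyMeasurable.aemeasurable.ennreal_ofReal.restrict).1 h0
      rw [← lintegral_zero (μ := volume.restrict (Cube a h))]
      refine lintegral_congr_ae ?_
      filter_upwards [h1] with x hx
      rw [ENNReal.ofReal_mul (by positivity), hx, Pi.zero_apply, mul_zero]
    rw [hz, ENNReal.zero_div, ENNReal.zero_rpow_of_pos hr]
    exact zero_le
  · have h1 := (lintegral_rpow_osc_le hp hw hb hB.ne a hh).trans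
      (mul_le_mul' le_rfl (mul_le_mul' le_rfl (lintegral_maxFn_le hw.2 hh h0)))
    rw [← mul_assoc _ (fwConst w), ← mul_assoc _ _ (wInt w a h),
      ← ENNReal.div_le_iff_le_mul (Or.inl h0) (Or.inl (wInt_ne_top hw.2 a h))] at h1
    refine (ENNReal.rpow_le_rpow h1 hr.le).trans (le_of_eq ?_)
    rw [ENNReal.mul_rpow_of_nonneg _ _ hr.le, ENNReal.mul_rpow_of_nonneg _ _ hr.le,
      ENNReal.mul_rpow_of_nonneg _ _ hr.le, ← ENNReal.rpow_mul, ← ENNReal.rpow_mul,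
      ← ENNReal.rpow_mul, hqr, ENNReal.rpow_one, ENNReal.rpow_one,
      show 1 / (p - 1) * ((p - 1) / p) = 1 / p by field_simp,
      ENNReal.ofReal_mul (by norm_num), ENNReal.ofReal_mul (by positivity),
      ENNReal.ofReal_pow (by norm_num), ENNReal.ofReal_ofNat, ENNReal.ofReal_ofNat]
    rw [show (2 : ℝ≥0∞) ^ (n + 3) = 2 ^ (n + 1) * 4 by rw [pow_add, pow_add]; norm_num; ring]
    ring
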